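/- arXiv:2410.07024 — 4 statements merged into one kernel-verified Lean document; each statement's English description precedes it below -/
import Mathlib

section
/- Hadamard-sandwiched generalized classical circuits have exactly 2^n coherent paths: let n ≥ 1, let f be a bijection of Fin n → ZMod 2 and φ : (Fin n → ZMod 2) → ℝ, and let D be the matrix with D y x = Complex.exp (Complex.I * φ x) if y = f x and 0 otherwise. Then for all a, b : Fin n → ZMod 2, (H^{⊗n} * D * H^{⊗n}) b a = (1/2^n) * ∑_{x : Fin n → ZMod 2} (-1)^((∑ i, a i * x i).val) * (-1)^((∑ i, b i * (f x) i).val) * Complex.exp (Complex.I * φ x). In particular the transition amplitude is a uniform sum of 2^n paths, i.e., the path coherence of such circuits is n. -/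
/-- The full Hadamard layer `H^{⊗n}`. -/
noncomputable def Hlayer (n : ℕ) : Matrix (Fin n → ZMod 2) (Fin n → ZMod 2) ℂ :=
  Matrix.of fun y x =>
    ((((Real.sqrt 2)⁻¹ : ℝ) : ℂ)) ^ n * (-1 : ℂ) ^ ((∑ i, x i * y i).val)

/-- Hadamard-sandwiched generalized classical circuits have exactly `2^n` coherent
paths: if `D y x = exp(i φ(x))` when `y = f x` and `0` otherwise, then
`(H^{⊗n} D H^{⊗n}) b a = (1/2^n) ∑_x (-1)^(a·x) (-1)^(b·f(x)) exp(i φ(x))`: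
a uniform sum of `2^n` paths, i.e., the path coherence of such circuits is `n`. -/
theorem hadamard_sandwich_paths {n : ℕ} (hn : 1 ≤ n)
    (f : (Fin n → ZMod 2) ≃ (Fin n → ZMod 2))
    (φ : (Fin n → ZMod 2) → ℝ)
    (D : Matrix (Fin n → ZMod 2) (Fin n → ZMod 2) ℂ)
    (hD : ∀ x y, D y x = if y = f x then Complex.exp (Complex.I * (φ x : ℂ)) else 0)
    (a b : Fin n → ZMod 2) :
    (Hlayer n * D * Hlayer n) b a =
      (1 / 2 ^ n : ℂ) * ∑ x : Fin n → ZMod 2,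
        (-1 : ℂ) ^ ((∑ i, a i * x i).val) * (-1 : ℂ) ^ ((∑ i, b i * f x i).val) *
          Complex.exp (Complex.I * (φ x : ℂ)) := by
  have hc : (((Real.sqrt 2)⁻¹ : ℝ) : ℂ) ^ n * (((Real.sqrt 2)⁻¹ : ℝ) : ℂ) ^ n = 1 / 2 ^ n := by
    have h : (Real.sqrt 2)⁻¹ * (Real.sqrt 2)⁻¹ = (2 : ℝ)⁻¹ := by
      rw [← mul_inv, Real.mul_self_sqrt zero_le_two]
    rw [← mul_pow, ← Complex.ofReal_mul, h]
    simp
  rw [Matrix.mul_apply, Finset.mul_sum, ← hc]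
  refine Finset.sum_congr rfl fun x _ => ?_
  simp only [Matrix.mul_apply, hD, mul_ite, mul_zero, Finset.sum_ite_eq',
    Finset.mem_univ, if_true, Hlayer, Matrix.of_apply, mul_comm (b _)]
  ring
end

section
/- Proposition (rank of the path-coherence matrix K): let F be a field, h, n ≥ 1, and A : Matrix (Fin n) (Fin (h+n)) F. Let A_x be the n×h matrix of the first h columns of A. Let Z be the h×(h+n) matrix (I_h 0) and Z̄ the n×(h+n) matrix (0 I_n). Let G be any generalized inverse of A, set B := Z̄ * (1 − G * A) (with 1 the (h+n)×(h+n) identity), let G_B be any generalized inverse of B, and set K := Z * (1 − G * A) * (1 − G_B * B). Then K.rank = h − A_x.rank. -/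
/-- The `h × (h+n)` matrix `(I_h 0)`. -/
def Zleft (F : Type*) [Zero F] [One F] (h n : ℕ) : Matrix (Fin h) (Fin (h + n)) F :=
  Matrix.of fun i j => if (j : ℕ) = (i : ℕ) then 1 else 0

/-- The `n × (h+n)` matrix `(0 I_n)`. -/
def Zright (F : Type*) [Zero F] [One F] (h n : ℕ) : Matrix (Fin n) (Fin (h + n)) F :=
  Matrix.of fun i j => if (j : ℕ) = h + (i : ℕ) then 1 else 0

theorem Zleft_eq_submatrix_one (F : Type*) [Field F] (h n : ℕ) :
    Zleft F h n = (1 : Matrix (Fin (h + n)) (Fin (h + n)) F).submatrix (Fin.castAdd n) id := by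
  ext i j
  simp [Zleft, Matrix.one_apply, Fin.ext_iff, eq_comm]

theorem Zright_eq_submatrix_one (F : Type*) [Field F] (h n : ℕ) :
    Zright F h n = (1 : Matrix (Fin (h + n)) (Fin (h + n)) F).submatrix (Fin.natAdd h) id := by
  ext i j
  simp [Zright, Matrix.one_apply, Fin.ext_iff, eq_comm]

theorem mul_transpose_Zleft {F : Type*} [Field F] {h n : ℕ} {m : Type*}
    (A : Matrix m (Fin (h + n)) F) :
    A * (Zleft F h n).transpose = A.submatrix id (Fin.castAdd n) := by
  ext i j
  simp [Zleft_eq_submatrix_one, Matrix.mul_apply, Matrix.one_apply]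

theorem Zleft_mul_transpose_Zleft (F : Type*) [Field F] (h n : ℕ) :
    Zleft F h n * (Zleft F h n).transpose = 1 := by
  ext i j
  rw [mul_transpose_Zleft, Zleft_eq_submatrix_one]
  simp [Matrix.one_apply]

theorem Zright_mul_transpose_Zleft (F : Type*) [Field F] (h n : ℕ) :
    Zright F h n * (Zleft F h n).transpose = 0 := by
  ext i j
  rw [mul_transpose_Zleft, Zright_eq_submatrix_one]
  simp only [Matrix.submatrix_apply, id_eq, Matrix.one_apply, Fin.ext_iff, Fin.val_natAdd,
    Fin.val_castAdd, Matrix.zero_apply, ite_eq_right_iff]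
  omega

theorem transpose_mul_Zleft_add_transpose_mul_Zright (F : Type*) [Field F] (h n : ℕ) :
    (Zleft F h n).transpose * Zleft F h n + (Zright F h n).transpose * Zright F h n = 1 := by
  rw [← Matrix.one_mul (1 : Matrix (Fin (h + n)) (Fin (h + n)) F)]
  nth_rw 1 [← Matrix.transpose_one]
  ext i j
  simp only [Zleft_eq_submatrix_one, Zright_eq_submatrix_one, Matrix.add_apply, Matrix.mul_apply,
    Matrix.transpose_apply, Matrix.submatrix_apply, Fin.sum_univ_add]
  rfl

/-- If `M * K = 0` and `K * W` fixes the kernel of `M`, then the range of `K` is the kernel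
of `M`, so that the two ranks are complementary. -/
theorem Matrix.rank_eq_sub_rank_of_range_eq_ker {F l m p : Type*} [Field F] [Fintype l]
    [Fintype m] (M : Matrix p l F) (K : Matrix l m F) (W : Matrix m l F)
    (hMK : M * K = 0) (hfix : ∀ x, M.mulVec x = 0 → K.mulVec (W.mulVec x) = x) :
    K.rank = Fintype.card l - M.rank := by
  have hrange : LinearMap.range K.mulVecLin = LinearMap.ker M.mulVecLin := by
    ext x
    simp only [LinearMap.mem_range, LinearMap.mem_ker, Matrix.mulVecLin_apply]
    constructor
    · rintro ⟨y, rfl⟩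
      rw [Matrix.mulVec_mulVec, hMK, Matrix.zero_mulVec]
    · exact fun hx => ⟨_, hfix x hx⟩
  have hdim := M.mulVecLin.finrank_range_add_finrank_ker
  rw [Module.finrank_pi] at hdim
  rw [Matrix.rank, Matrix.rank, hrange]
  omega

/-- Rank of the path-coherence matrix `K`: with `A_x` the first `h` columns of `A`,
`B := Z̄ (1 - G A)` and `K := Z (1 - G A) (1 - G_B B)` for generalized inverses `G` of `A`
and `G_B` of `B`, one has `K.rank = h - A_x.rank`. -/
theorem rank_path_coherence_matrix {F : Type*} [Field F] {h n : ℕ}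
    (hh : 1 ≤ h) (hn : 1 ≤ n)
    (A : Matrix (Fin n) (Fin (h + n)) F)
    (G : Matrix (Fin (h + n)) (Fin n) F) (hG : A * G * A = A)
    (GB : Matrix (Fin (h + n)) (Fin n) F)
    (hGB : (Zright F h n * ((1 : Matrix (Fin (h + n)) (Fin (h + n)) F) - G * A)) * GB *
          (Zright F h n * ((1 : Matrix (Fin (h + n)) (Fin (h + n)) F) - G * A))
        = Zright F h n * ((1 : Matrix (Fin (h + n)) (Fin (h + n)) F) - G * A)) :
    (Zleft F h n * ((1 : Matrix (Fin (h + n)) (Fin (h + n)) F) - G * A) *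
        ((1 : Matrix (Fin (h + n)) (Fin (h + n)) F) -
          GB * (Zright F h n * ((1 : Matrix (Fin (h + n)) (Fin (h + n)) F) - G * A)))).rank
      = h - (A.submatrix id (Fin.castAdd n)).rank := by
  set Z := Zleft F h n
  set Y := Zright F h n
  set B := Y * (1 - G * A) with hB
  have hAP : A * (1 - G * A) = 0 := by
    rw [Matrix.mul_sub, Matrix.mul_one, ← Matrix.mul_assoc, hG, sub_self]
  have hBQ : B * (1 - GB * B) = 0 := by
    rw [Matrix.mul_sub, Matrix.mul_one, ← Matrix.mul_assoc, hGB, sub_self]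
  have hZZ : Z.transpose * Z = 1 - Y.transpose * Y :=
    eq_sub_of_add_eq (transpose_mul_Zleft_add_transpose_mul_Zright F h n)
  rw [← mul_transpose_Zleft]
  convert Matrix.rank_eq_sub_rank_of_range_eq_ker (A * Z.transpose) _ Z.transpose ?_ ?_
  · simp
  · calc A * Z.transpose * (Z * (1 - G * A) * (1 - GB * B))
        = A * (Z.transpose * Z) * (1 - G * A) * (1 - GB * B) := by
          simp only [Matrix.mul_assoc]
      _ = A * (1 - G * A) * (1 - GB * B) - A * Y.transpose * (B * (1 - GB * B)) := by
          rw [hZZ, hB]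
          simp only [Matrix.mul_sub, Matrix.sub_mul, Matrix.mul_assoc, Matrix.mul_one]
          abel
      _ = 0 := by rw [hAP, hBQ, Matrix.zero_mul, Matrix.mul_zero, sub_zero]
  · intro x hx
    have hAx : A.mulVec (Z.transpose.mulVec x) = 0 := by rw [Matrix.mulVec_mulVec, hx]
    have hPx : (1 - G * A).mulVec (Z.transpose.mulVec x) = Z.transpose.mulVec x := by
      rw [Matrix.sub_mulVec, Matrix.one_mulVec, ← Matrix.mulVec_mulVec, hAx, Matrix.mulVec_zero,
        sub_zero]
    have hBx : B.mulVec (Z.transpose.mulVec x) = 0 := by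
      rw [hB, ← Matrix.mulVec_mulVec, hPx, Matrix.mulVec_mulVec, Zright_mul_transpose_Zleft,
        Matrix.zero_mulVec]
    have hQx : (1 - GB * B).mulVec (Z.transpose.mulVec x) = Z.transpose.mulVec x := by
      rw [Matrix.sub_mulVec, Matrix.one_mulVec, ← Matrix.mulVec_mulVec, hBx, Matrix.mulVec_zero,
        sub_zero]
    rw [← Matrix.mulVec_mulVec, hQx, ← Matrix.mulVec_mulVec, hPx, Matrix.mulVec_mulVec,
      Zleft_mul_transpose_Zleft, Matrix.one_mulVec]
end

section
/- Structure and monotonicity of the path-variable block along the circuit construction: let F be a field, n ≥ 1, h ≥ 0, and let A : Matrix (Fin n) (Fin (h+n)) F with first-h-columns block A_x and last-n-columns block A_a. For every M ∈ GL_n(F), the matrix A' := A * S_{h+1,n} * (I_{h+1} ⊕ M) of size n×(h+1+n) has its block of first h+1 columns equal to the matrix [c | A_x], where c is the first column of A_a. Consequently, the rank of the first-(h+1)-columns block of A' equals A_x.rank + 1 if c is not in the span of the columns of A_x, and equals A_x.rank otherwise; in particular, along the construction A^{(h)}, the rank of A_x^{(h)} is a nondecreasing function of h. -/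
/-- The `(n+k-1) × (n+k)` matrix `S_{k,n}` (here with `k = h+1`, of size
`(h+n) × (h+1+n)`): acting on a column vector of length `n+k`, it swaps the first
and `(k+1)`-st entries and then deletes the first entry. -/
def Sstep (F : Type*) [Zero F] [One F] (h n : ℕ) :
    Matrix (Fin (h + n)) (Fin (h + 1 + n)) F :=
  Matrix.of fun i j =>
    if (i : ℕ) + 1 = h + 1 then (if (j : ℕ) = 0 then 1 else 0)
    else if (j : ℕ) = (i : ℕ) + 1 then 1 else 0

/-- The block-diagonal matrix `I_k ⊕ M` of size `(k+n) × (k+n)`. -/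
def blockDiag (F : Type*) [Zero F] [One F] (k n : ℕ) (M : Matrix (Fin n) (Fin n) F) :
    Matrix (Fin (k + n)) (Fin (k + n)) F :=
  (Matrix.fromBlocks (1 : Matrix (Fin k) (Fin k) F) 0 0 M).submatrix
    finSumFinEquiv.symm finSumFinEquiv.symm

/-- The block of the first `h` columns of an `n × (h+n)` matrix. -/
def firstCols {F : Type*} {n h : ℕ} (A : Matrix (Fin n) (Fin (h + n)) F) :
    Matrix (Fin n) (Fin h) F :=
  A.submatrix id (Fin.castAdd n)

/-- The `n × (h+n)` matrix `A^{(h)} = A₀ S_{1,n} (I_1 ⊕ A₁) ⋯ S_{h,n} (I_h ⊕ A_h)`. -/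
def Acirc (F : Type*) [Field F] (n : ℕ) (As : ℕ → Matrix (Fin n) (Fin n) F) :
    (h : ℕ) → Matrix (Fin n) (Fin (h + n)) F
  | 0 => (As 0).submatrix id (Fin.cast (Nat.zero_add n))
  | h + 1 => Acirc F n As h * Sstep F h n * blockDiag F (h + 1) n (As (h + 1))

/-- Multiplying on the right by `I_k ⊕ M` leaves the first `k` columns unchanged. -/
theorem mul_blockDiag_apply_castAdd {R m : Type*} [Semiring R] {k n : ℕ}
    (B : Matrix m (Fin (k + n)) R) (M : Matrix (Fin n) (Fin n) R) (i : m) (j : Fin k) :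
    (B * blockDiag R k n M) i (Fin.castAdd n j) = B i (Fin.castAdd n j) := by
  simp [Matrix.mul_apply, blockDiag, Fin.sum_univ_add, Matrix.one_apply]

/-- The first column of `B * S_{h+1,n}` is the column of `B` with index `h`. -/
theorem mul_Sstep_apply_zero {R m : Type*} [Semiring R] {h n : ℕ} [NeZero n]
    (B : Matrix m (Fin (h + n)) R) (i : m) :
    (B * Sstep R h n) i (Fin.castAdd n 0) = B i (Fin.natAdd h 0) := by
  rw [Matrix.mul_apply, Finset.sum_eq_single (Fin.natAdd h 0)]
  · simp [Sstep, -Fin.val_eq_zero_iff]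
  · intro b _ hb
    have hb' : (b : ℕ) ≠ h := fun e => hb (Fin.ext (by simpa using e))
    simp [Sstep, hb']
  · simp

/-- Column `j + 1` of `B * S_{h+1,n}`, for `j < h`, is column `j` of `B`. -/
theorem mul_Sstep_apply_succ {R m : Type*} [Semiring R] {h n : ℕ}
    (B : Matrix m (Fin (h + n)) R) (i : m) (j : Fin h) :
    (B * Sstep R h n) i (Fin.castAdd n j.succ) = B i (Fin.castAdd n j) := by
  rw [Matrix.mul_apply, Finset.sum_eq_single (Fin.castAdd n j)]
  · simp [Sstep, j.isLt.ne]
  · intro b _ hb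
    have hb' : (j : ℕ) ≠ b := fun e => hb (Fin.ext (by simpa using e.symm))
    simp [Sstep, hb', -Fin.val_eq_zero_iff]
  · simp

/-- The column space of the first `h + 1` columns of `A * S_{h+1,n} * (I_{h+1} ⊕ M)` is the
column space of the first `h` columns of `A` enlarged by the next column of `A`. -/
theorem range_mulVecLin_firstCols_step {R : Type*} [CommSemiring R] {h n : ℕ} [NeZero n]
    (A : Matrix (Fin n) (Fin (h + n)) R) (M : Matrix (Fin n) (Fin n) R) :
    LinearMap.range (firstCols (A * Sstep R h n * blockDiag R (h + 1) n M)).mulVecLin =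
      LinearMap.range (firstCols A).mulVecLin ⊔
        Submodule.span R {fun i => A i (Fin.natAdd h 0)} := by
  have hcols : (firstCols (A * Sstep R h n * blockDiag R (h + 1) n M)).col =
      Fin.cons (fun i => A i (Fin.natAdd h 0)) (firstCols A).col := by
    funext j i
    refine Fin.cases ?_ (fun j => ?_) j
    · exact (mul_blockDiag_apply_castAdd _ _ _ _).trans (mul_Sstep_apply_zero _ _)
    · exact (mul_blockDiag_apply_castAdd _ _ _ _).trans (mul_Sstep_apply_succ _ _ _)
  rw [Matrix.range_mulVecLin, Matrix.range_mulVecLin, hcols, Fin.range_cons,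
    Submodule.span_insert, sup_comm]

/-- Structure and monotonicity of the path-variable block along the circuit
construction: for `A : n × (h+n)` and `M ∈ GL_n(F)`, the first `h+1` columns of
`A' := A * S_{h+1,n} * (I_{h+1} ⊕ M)` are `[c | A_x]` where `c` is the first column
of the last-`n`-columns block `A_a` of `A`; consequently the rank of this block is
`A_x.rank + 1` if `c` is not in the column span of `A_x` and `A_x.rank` otherwise;
in particular, along the construction `A^{(h)}`, the rank of `A_x^{(h)}` is a
nondecreasing function of `h`. -/
theorem pathBlock_structure_and_rank_monotone {F : Type*} [Field F] {n h : ℕ}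
    [NeZero n]
    (A : Matrix (Fin n) (Fin (h + n)) F) (M : Matrix.GeneralLinearGroup (Fin n) F) :
    (∀ i, (A * Sstep F h n * blockDiag F (h + 1) n (M : Matrix (Fin n) (Fin n) F)) i
        (Fin.castAdd n (0 : Fin (h + 1))) = A i (Fin.natAdd h (0 : Fin n))) ∧
    (∀ i (j : Fin h), (A * Sstep F h n * blockDiag F (h + 1) n (M : Matrix (Fin n) (Fin n) F)) i
        (Fin.castAdd n j.succ) = A i (Fin.castAdd n j)) ∧
    ((fun i => A i (Fin.natAdd h (0 : Fin n))) ∉ LinearMap.range (firstCols A).mulVecLin →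
      (firstCols (A * Sstep F h n * blockDiag F (h + 1) n (M : Matrix (Fin n) (Fin n) F))).rank
        = (firstCols A).rank + 1) ∧
    ((fun i => A i (Fin.natAdd h (0 : Fin n))) ∈ LinearMap.range (firstCols A).mulVecLin →
      (firstCols (A * Sstep F h n * blockDiag F (h + 1) n (M : Matrix (Fin n) (Fin n) F))).rank
        = (firstCols A).rank) ∧
    (∀ (As : ℕ → Matrix.GeneralLinearGroup (Fin n) F) (h' : ℕ),
      (firstCols (Acirc F n (fun i => (As i : Matrix (Fin n) (Fin n) F)) h')).rank ≤
        (firstCols (Acirc F n (fun i => (As i : Matrix (Fin n) (Fin n) F)) (h' + 1))).rank) := by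
  refine ⟨fun i => ?_, fun i j => ?_, fun hc => ?_, fun hc => ?_, fun As h' => ?_⟩
  · exact (mul_blockDiag_apply_castAdd _ _ _ _).trans (mul_Sstep_apply_zero _ _)
  · exact (mul_blockDiag_apply_castAdd _ _ _ _).trans (mul_Sstep_apply_succ _ _ _)
  · rw [Matrix.rank, Matrix.rank, range_mulVecLin_firstCols_step]
    exact Submodule.finrank_sup_span_singleton hc
  · rw [Matrix.rank, Matrix.rank, range_mulVecLin_firstCols_step,
      sup_eq_left.2 ((Submodule.span_singleton_le_iff_mem _ _).2 hc)]
  · rw [Matrix.rank, Matrix.rank, Acirc, range_mulVecLin_firstCols_step]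
    exact Submodule.finrank_mono le_sup_left
end

section
/- Random circuits with generalized classical linear gates have high path coherence rank asymptotically (Theorem: the probability that rank(A_x^{(h)}) ≥ h/2 tends to 1): let F be a finite field, fix a real β > 1/2, and for each h ∈ ℕ set n(h) := ⌈β * h⌉. Then the sequence of ratios Fintype.card {(A₀,…,A_h) ∈ GL_{n(h)}(F)^{h+1} | 2 * (A_x^{(h)}).rank ≥ h} / (Fintype.card (GL_{n(h)}(F)))^{h+1}, viewed in ℝ, tends to 1 as h → ∞. Equivalently, when the invertible matrices A₀,…,A_h are drawn independently and uniformly from GL_{n(h)}(F), the event rank(A_x^{(h)}) ≥ h/2 holds with probability tending to 1, i.e., the path coherence h − rank(A_x^{(h)}) is at most h/2 almost surely in the limit. -/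
section Counting

variable {F : Type*} [Field F] {n : ℕ}

/-- The row vector `f * M₀ * ⋯ * M_{k-1}`. -/
def prodRow (f : Fin n → F) (M : ℕ → Matrix (Fin n) (Fin n) F) : ℕ → (Fin n → F)
  | 0 => f
  | k + 1 => Matrix.vecMul (prodRow f M k) (M k)

theorem prodRow_congr (f : Fin n → F) {M N : ℕ → Matrix (Fin n) (Fin n) F} {k : ℕ}
    (h : ∀ i < k, M i = N i) : prodRow f M k = prodRow f N k := by
  induction k with
  | zero => rfl
  | succ k ih =>
    simp only [prodRow]
    rw [ih fun i hi => h i (by omega), h k (by omega)]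

theorem vecMul_Sstep_zero (h : ℕ) (hn : 0 < n) (φ : Fin (h + n) → F) :
    Matrix.vecMul φ (Sstep F h n) (Fin.castAdd n 0) = φ (Fin.natAdd h ⟨0, hn⟩) := by
  rw [Matrix.vecMul, dotProduct, Finset.sum_eq_single (Fin.natAdd h ⟨0, hn⟩)]
  · simp [-Fin.val_eq_zero_iff, Sstep]
  · intro b _ hb
    have : (b : ℕ) ≠ h := fun hb' => hb (Fin.ext (by simpa using hb'))
    simp [-Fin.val_eq_zero_iff, Sstep, this]
  · simp

theorem vecMul_Sstep_succ (h : ℕ) (φ : Fin (h + n) → F) (j : Fin h) :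
    Matrix.vecMul φ (Sstep F h n) (Fin.castAdd n j.succ) = φ (Fin.castAdd n j) := by
  rw [Matrix.vecMul, dotProduct, Finset.sum_eq_single (Fin.castAdd n j)]
  · simp [-Fin.val_eq_zero_iff, Sstep, j.2.ne]
  · intro b _ hb
    have : (j : ℕ) ≠ b := fun hb' => hb (Fin.ext (by simpa using hb'.symm))
    simp [-Fin.val_eq_zero_iff, Sstep, this]
  · simp

theorem vecMul_Sstep_natAdd (h : ℕ) (hn : 0 < n) (φ : Fin (h + n) → F) (i : Fin n) :
    Matrix.vecMul φ (Sstep F h n) (Fin.natAdd (h + 1) i) =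
      if i = ⟨0, hn⟩ then 0 else φ (Fin.natAdd h i) := by
  rw [Matrix.vecMul, dotProduct, Finset.sum_eq_single (Fin.natAdd h i)]
  · have : h + 1 + (i : ℕ) = h + i + 1 := by omega
    simp [-Fin.val_eq_zero_iff, Sstep, Fin.ext_iff, this]
  · intro b _ hb
    have : h + 1 + (i : ℕ) ≠ b + 1 := fun hb' => hb (Fin.ext (by simp; omega))
    simp [-Fin.val_eq_zero_iff, Sstep, this]
  · simp

theorem vecMul_blockDiag_castAdd (k : ℕ) (M : Matrix (Fin n) (Fin n) F)
    (ψ : Fin (k + n) → F) (j : Fin k) :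
    Matrix.vecMul ψ (blockDiag F k n M) (Fin.castAdd n j) = ψ (Fin.castAdd n j) := by
  simp [Matrix.vecMul, dotProduct, blockDiag, Fin.sum_univ_add, Matrix.one_apply]

theorem vecMul_blockDiag_natAdd (k : ℕ) (M : Matrix (Fin n) (Fin n) F)
    (ψ : Fin (k + n) → F) (j : Fin n) :
    Matrix.vecMul ψ (blockDiag F k n M) (Fin.natAdd k j) =
      Matrix.vecMul (fun i => ψ (Fin.natAdd k i)) M j := by
  simp [Matrix.vecMul, dotProduct, blockDiag, Fin.sum_univ_add]

theorem vecMul_Acirc_of_firstCols_eq_zero (hn : 0 < n) (f : Fin n → F)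
    (M : ℕ → Matrix (Fin n) (Fin n) F) (h : ℕ)
    (hf : ∀ j : Fin h, Matrix.vecMul f (Acirc F n M h) (Fin.castAdd n j) = 0) :
    (∀ k < h, prodRow f M (k + 1) ⟨0, hn⟩ = 0) ∧
      ∀ i, Matrix.vecMul f (Acirc F n M h) (Fin.natAdd h i) = prodRow f M (h + 1) i := by
  induction h with
  | zero =>
    refine ⟨by simp, fun i => ?_⟩
    simp only [Acirc, prodRow, Matrix.vecMul, dotProduct, Matrix.submatrix_apply, id]
    congr! 3
    ext; simp
  | succ h ih =>
    simp only [Acirc, ← Matrix.vecMul_vecMul, vecMul_blockDiag_castAdd,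
      vecMul_blockDiag_natAdd] at hf ⊢
    have h0 := hf 0
    rw [vecMul_Sstep_zero h hn] at h0
    obtain ⟨ih1, ih2⟩ := ih fun j => (vecMul_Sstep_succ h _ j).symm.trans (hf j.succ)
    refine ⟨fun k hk => ?_, fun i => ?_⟩
    · rcases Nat.lt_succ_iff_lt_or_eq.1 hk with hk | rfl
      · exact ih1 k hk
      · rw [← ih2, h0]
    · rw [prodRow]
      congr 1
      ext i
      rw [vecMul_Sstep_natAdd h hn, ← ih2]
      split_ifs with hi
      · rw [hi, h0]
      · rfl

theorem exists_vecMul_eq_update {w : Fin n → F} {z : Fin n} (hw : w ≠ 0) (hz : w z = 0) (t : F) :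
    ∃ B : Matrix.GeneralLinearGroup (Fin n) F,
      Matrix.vecMul w (B : Matrix (Fin n) (Fin n) F) = Function.update w z t := by
  obtain ⟨j, hj⟩ := Function.ne_iff.1 hw
  have hjz : j ≠ z := by rintro rfl; exact hj hz
  refine ⟨Matrix.GeneralLinearGroup.mkOfDetNeZero (Matrix.transvection j z (t / w j))
    (by rw [Matrix.det_transvection_of_ne _ _ hjz]; exact one_ne_zero), ?_⟩
  ext i
  change Matrix.vecMul w (Matrix.transvection j z (t / w j)) i = _
  have hj' : w j ≠ 0 := hj
  rw [Matrix.transvection, Matrix.vecMul_add, Matrix.vecMul_one, Pi.add_apply, Matrix.vecMul,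
    dotProduct, Finset.sum_eq_single j]
  · by_cases hi : i = z
    · subst hi
      simp [hz, mul_div_cancel₀ _ hj']
    · simp [hi, Ne.symm hi]
  · intro b _ hb
    simp [hb.symm]
  · simp

theorem vecMul_GL_ne_zero {v : Fin n → F} (hv : v ≠ 0)
    (A : Matrix.GeneralLinearGroup (Fin n) F) :
    Matrix.vecMul v (A : Matrix (Fin n) (Fin n) F) ≠ 0 := by
  intro h
  apply hv
  have := congrArg (fun u => Matrix.vecMul u ((A⁻¹ : Matrix.GeneralLinearGroup (Fin n) F) :
    Matrix (Fin n) (Fin n) F)) h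
  simpa [Matrix.vecMul_vecMul, ← Matrix.GeneralLinearGroup.coe_mul, -Matrix.coe_units_inv]
    using this

/-- Extend a finite family of invertible matrices by the identity. -/
abbrev extendGL {m : ℕ} (A : Fin m → Matrix.GeneralLinearGroup (Fin n) F) (i : ℕ) :
    Matrix (Fin n) (Fin n) F :=
  if hi : i < m then (A ⟨i, hi⟩ : Matrix (Fin n) (Fin n) F) else 1

theorem prodRow_extendGL_ne_zero {m : ℕ} (A : Fin m → Matrix.GeneralLinearGroup (Fin n) F)
    {f : Fin n → F} (hf : f ≠ 0) (k : ℕ) : prodRow f (extendGL A) k ≠ 0 := by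
  induction k with
  | zero => exact hf
  | succ k ih =>
    rw [prodRow, extendGL]
    split_ifs
    · exact vecMul_GL_ne_zero ih _
    · simpa using ih

variable [Fintype F] [DecidableEq F]

open Classical in
/-- The families of matrices whose partial products send `f` into the hyperplane `x_z = 0`
for the first `k` steps. -/
noncomputable def hyperplaneFamilies (m : ℕ) (f : Fin n → F) (z : Fin n) (k : ℕ) :
    Finset (Fin m → Matrix.GeneralLinearGroup (Fin n) F) :=
  Finset.univ.filter fun A => ∀ i < k, prodRow f (extendGL A) (i + 1) z = 0

theorem card_hyperplaneFamilies_succ_mul_le {m k : ℕ} (hk : k < m) {f : Fin n → F} (hf : f ≠ 0)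
    (z : Fin n) :
    (hyperplaneFamilies m f z (k + 1)).card * Fintype.card F ≤
      (hyperplaneFamilies m f z k).card := by
  classical
  have hex (w : Fin n → F) (t : F) : ∃ B : Matrix.GeneralLinearGroup (Fin n) F,
      w ≠ 0 → w z = 0 → Matrix.vecMul w (B : Matrix (Fin n) (Fin n) F) = Function.update w z t := by
    by_cases h : w ≠ 0 ∧ w z = 0
    · obtain ⟨B, hB⟩ := exists_vecMul_eq_update h.1 h.2 t
      exact ⟨B, fun _ _ => hB⟩
    · exact ⟨1, fun h1 h2 => (h ⟨h1, h2⟩).elim⟩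
  choose B hB using hex
  let K : Fin m := ⟨k, hk⟩
  let Φ (p : (Fin m → Matrix.GeneralLinearGroup (Fin n) F) × F) :
      Fin m → Matrix.GeneralLinearGroup (Fin n) F :=
    Function.update p.1 K (p.1 K * B (prodRow f (extendGL p.1) (k + 1)) p.2)
  have hΦ_lt (p) (i : ℕ) (hi : i < k) : extendGL (Φ p) i = extendGL p.1 i := by
    have : (⟨i, hi.trans hk⟩ : Fin m) ≠ K := by simp [K, Fin.ext_iff, hi.ne]
    simp [extendGL, Φ, hi.trans hk, Function.update_of_ne this]
  have hrow (p) (i : ℕ) (hi : i ≤ k) :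
      prodRow f (extendGL (Φ p)) i = prodRow f (extendGL p.1) i :=
    prodRow_congr f fun j hj => hΦ_lt p j (by omega)
  have hrow_succ (p) (hp : prodRow f (extendGL p.1) (k + 1) z = 0) :
      prodRow f (extendGL (Φ p)) (k + 1) =
        Function.update (prodRow f (extendGL p.1) (k + 1)) z p.2 := by
    rw [← hB _ _ (prodRow_extendGL_ne_zero p.1 hf _) hp]
    rw [prodRow, hrow p k le_rfl]
    conv_rhs => enter [1]; rw [prodRow]
    rw [Matrix.vecMul_vecMul]
    simp [extendGL, hk, Φ, K]
  rw [← Finset.card_univ, ← Finset.card_product]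
  refine Finset.card_le_card_of_injOn Φ ?_ ?_
  · intro p hp
    simp only [hyperplaneFamilies, Finset.coe_product, Finset.coe_filter, Finset.mem_univ,
      true_and, Set.mem_prod, Set.mem_ofPred_eq] at hp ⊢
    intro i hi
    rw [hrow p _ hi]
    exact hp.1 i (by omega)
  · intro p hp p' hp' heq
    simp only [hyperplaneFamilies, Finset.coe_product, Finset.coe_filter, Finset.mem_univ,
      true_and, Set.mem_prod, Set.mem_ofPred_eq] at hp hp'
    have hz := hp.1 k (by omega)
    have hz' := hp'.1 k (by omega)
    have hu : Function.update (prodRow f (extendGL p.1) (k + 1)) z p.2 =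
        Function.update (prodRow f (extendGL p'.1) (k + 1)) z p'.2 := by
      rw [← hrow_succ p hz, ← hrow_succ p' hz', heq]
    have ht : p.2 = p'.2 := by simpa using congrFun hu z
    have hr : prodRow f (extendGL p.1) (k + 1) = prodRow f (extendGL p'.1) (k + 1) := by
      ext i
      by_cases hi : i = z
      · rw [hi, hz, hz']
      · simpa [hi] using congrFun hu i
    refine Prod.ext (funext fun i => ?_) ht
    have hi := congrFun heq i
    by_cases hiK : i = K
    · subst hiK
      simp only [Φ, Function.update_self] at hi
      rw [hr, ht] at hi
      exact mul_right_cancel hi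
    · simpa [Φ, hiK] using hi

theorem card_hyperplaneFamilies_mul_pow_le {m k : ℕ} (hk : k ≤ m) {f : Fin n → F} (hf : f ≠ 0)
    (z : Fin n) :
    (hyperplaneFamilies m f z k).card * Fintype.card F ^ k ≤
      Fintype.card (Matrix.GeneralLinearGroup (Fin n) F) ^ m := by
  induction k with
  | zero =>
    refine (by simpa using Finset.card_le_univ _ : _ ≤ _).trans (by simp)
  | succ k ih =>
    calc _ = ((hyperplaneFamilies m f z (k + 1)).card * Fintype.card F) * Fintype.card F ^ k := by
          ring
      _ ≤ _ := (Nat.mul_le_mul_right _ (card_hyperplaneFamilies_succ_mul_le hk hf z)).trans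
          (ih (by omega))

open Classical in
theorem pow_le_card_leftKernel {h s : ℕ} (X : Matrix (Fin n) (Fin h) F) (hX : X.rank ≤ s)
    (hs : s + 1 ≤ n) :
    Fintype.card F ^ (n - (s + 1)) ≤
      (Finset.univ.filter fun f : Fin n → F => f ≠ 0 ∧ Matrix.vecMul f X = 0).card := by
  have hq : 1 < Fintype.card F := Fintype.one_lt_card
  have hker : Fintype.card (LinearMap.ker X.vecMulLinear) = Fintype.card F ^ (n - X.rank) := by
    rw [Module.card_eq_pow_finrank (K := F)]
    congr 1
    have h1 := LinearMap.finrank_range_add_finrank_ker X.vecMulLinear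
    have h2 : Module.finrank F (LinearMap.range X.vecMulLinear) = X.rank := by
      rw [← Matrix.rank_transpose, Matrix.rank, Matrix.mulVecLin_transpose]
    rw [h2, Module.finrank_fin_fun] at h1
    omega
  have hcard : (Finset.univ.filter fun f : Fin n → F => f ≠ 0 ∧ Matrix.vecMul f X = 0).card =
      Fintype.card (LinearMap.ker X.vecMulLinear) - 1 := by
    rw [Fintype.card_of_subtype (Finset.univ.filter fun f => Matrix.vecMul f X = 0)
      (by simp [LinearMap.mem_ker]), ← Finset.card_erase_of_mem (a := (0 : Fin n → F)) (by simp)]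
    congr 1
    ext f
    simp
  rw [hcard, hker]
  have hpow : Fintype.card F ^ (n - (s + 1)) * Fintype.card F ≤ Fintype.card F ^ (n - X.rank) := by
    rw [← pow_succ]
    exact Nat.pow_le_pow_right hq.le (by omega)
  have hpos : 0 < Fintype.card F ^ (n - (s + 1)) := by positivity
  have := Nat.mul_le_mul_left (Fintype.card F ^ (n - (s + 1))) hq
  omega

open Classical in
theorem card_rank_lt_half_mul_pow_le {h : ℕ} (hn : h ≤ 2 * n) :
    (Finset.univ.filter fun A : Fin (h + 1) → Matrix.GeneralLinearGroup (Fin n) F =>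
        2 * (firstCols (Acirc F n (extendGL A) h)).rank < h).card * Fintype.card F ^ (h / 2) ≤
      Fintype.card (Matrix.GeneralLinearGroup (Fin n) F) ^ (h + 1) := by
  rcases Nat.eq_zero_or_pos h with rfl | hpos
  · simp
  have hn0 : 0 < n := by omega
  set Bad := Finset.univ.filter fun A : Fin (h + 1) → Matrix.GeneralLinearGroup (Fin n) F =>
    2 * (firstCols (Acirc F n (extendGL A) h)).rank < h with hBad
  set q := Fintype.card F
  set G := Fintype.card (Matrix.GeneralLinearGroup (Fin n) F)
  have hq : 0 < q := Fintype.card_pos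
  obtain ⟨s, hs⟩ : ∃ s, s = (h - 1) / 2 := ⟨_, rfl⟩
  have hdouble : Bad.card * q ^ (n - (s + 1)) ≤
      ∑ f ∈ Finset.univ.filter fun f : Fin n → F => f ≠ 0,
        (hyperplaneFamilies (h + 1) f ⟨0, hn0⟩ h).card := by
    rw [← smul_eq_mul]
    refine (Finset.card_nsmul_le_sum Bad
      (fun A => (Finset.univ.filter fun f : Fin n → F =>
        f ≠ 0 ∧ Matrix.vecMul f (firstCols (Acirc F n (extendGL A) h)) = 0).card) _
      fun A hA => pow_le_card_leftKernel _ ?_ (by omega)).trans ?_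
    · have := (Finset.mem_filter.1 hA).2
      omega
    · simp only [← Finset.filter_filter]
      refine (Finset.sum_card_bipartiteAbove_eq_sum_card_bipartiteBelow
        (s := Bad) (t := Finset.univ.filter fun f : Fin n → F => f ≠ 0)
        (fun A f => Matrix.vecMul f (firstCols (Acirc F n (extendGL A) h)) = 0)).trans_le ?_
      refine Finset.sum_le_sum fun f _ => Finset.card_le_card fun A hA => ?_
      have hA' := (Finset.mem_filter.1 hA).2
      simp only [hyperplaneFamilies, Finset.mem_filter, Finset.mem_univ, true_and]
      exact (vecMul_Acirc_of_firstCols_eq_zero hn0 f _ h fun j => congrFun hA' j).1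
  have hsum : (∑ f ∈ Finset.univ.filter fun f : Fin n → F => f ≠ 0,
      (hyperplaneFamilies (h + 1) f ⟨0, hn0⟩ h).card) * q ^ h ≤ q ^ n * G ^ (h + 1) := by
    rw [Finset.sum_mul]
    refine (Finset.sum_le_card_nsmul _ _ (G ^ (h + 1)) fun f hf =>
      card_hyperplaneFamilies_mul_pow_le (by omega) (Finset.mem_filter.1 hf).2 _).trans ?_
    rw [smul_eq_mul]
    refine Nat.mul_le_mul_right _ ((Finset.card_le_univ _).trans ?_)
    simp [q]
  have hmul : q ^ n * (Bad.card * q ^ (h / 2)) ≤ q ^ n * G ^ (h + 1) := by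
    calc q ^ n * (Bad.card * q ^ (h / 2))
        = Bad.card * q ^ (n - (s + 1)) * q ^ h := by
          have h1 : n + h / 2 = (n - (s + 1)) + h := by omega
          calc _ = Bad.card * q ^ (n + h / 2) := by rw [pow_add]; ring
            _ = _ := by rw [h1, pow_add]; ring
      _ ≤ _ := (Nat.mul_le_mul_right _ hdouble).trans hsum
  exact Nat.le_of_mul_le_mul_left hmul (by positivity)

end Counting

/-- Random circuits with generalized classical linear gates have high path coherence
rank asymptotically: for a finite field `F` and `β > 1/2`, with `n(h) := ⌈β h⌉`, the
fraction of `(h+1)`-tuples of invertible matrices in `GL_{n(h)}(F)` for which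
`rank(A_x^{(h)}) ≥ h/2` tends to `1` as `h → ∞`; i.e., for uniformly random
`A₀, …, A_h`, the path coherence `h - rank(A_x^{(h)})` is at most `h/2`
almost surely in the limit. -/
theorem rank_ge_half_tendsto_one {F : Type*} [Field F] [Fintype F] [DecidableEq F]
    (β : ℝ) (hβ : 1 / 2 < β) :
    Filter.Tendsto (fun h : ℕ =>
      (Fintype.card {A : Fin (h + 1) → Matrix.GeneralLinearGroup (Fin (⌈β * (h : ℝ)⌉₊)) F //
          h ≤ 2 * (firstCols (Acirc F (⌈β * (h : ℝ)⌉₊)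
            (fun i => if hi : i < h + 1 then
          ((A ⟨i, hi⟩ : Matrix (Fin (⌈β * (h : ℝ)⌉₊)) (Fin (⌈β * (h : ℝ)⌉₊)) F)) else 1)
            h)).rank} : ℝ) /
        (Fintype.card (Matrix.GeneralLinearGroup (Fin (⌈β * (h : ℝ)⌉₊)) F) : ℝ) ^ (h + 1))
      Filter.atTop (nhds 1) := by
  classical
  have hlow : Filter.Tendsto (fun h : ℕ => 1 - ((Fintype.card F : ℝ)⁻¹) ^ (h / 2))
      Filter.atTop (nhds 1) := by
    have hq : (1 : ℝ) < Fintype.card F := by exact_mod_cast Fintype.one_lt_card (α := F)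
    have h1 := (tendsto_pow_atTop_nhds_zero_of_lt_one (r := (Fintype.card F : ℝ)⁻¹)
      (by positivity) (inv_lt_one_of_one_lt₀ hq)).comp
      (Nat.tendsto_div_const_atTop (n := 2) (by norm_num))
    simpa using h1.const_sub 1
  refine tendsto_of_tendsto_of_tendsto_of_le_of_le hlow tendsto_const_nhds ?_ ?_
  all_goals
    intro h
    dsimp only
    set n := ⌈β * (h : ℝ)⌉₊ with hn_def
    set G := Fintype.card (Matrix.GeneralLinearGroup (Fin n) F)
    have hG : (0 : ℝ) < (G : ℝ) ^ (h + 1) := by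
      have : 0 < G := Fintype.card_pos
      positivity
  · have hn : h ≤ 2 * n := by
      have h1 : β * h ≤ n := Nat.le_ceil _
      have h2 : (1 / 2 : ℝ) * h ≤ β * h := by gcongr
      have h3 : (h : ℝ) ≤ 2 * n := by linarith
      exact_mod_cast h3
    have hbad := card_rank_lt_half_mul_pow_le (F := F) hn
    have hq : (0 : ℝ) < Fintype.card F := by exact_mod_cast Fintype.card_pos (α := F)
    have hsplit := Finset.card_filter_add_card_filter_not (s := Finset.univ)
      (fun A : Fin (h + 1) → Matrix.GeneralLinearGroup (Fin n) F =>
        h ≤ 2 * (firstCols (Acirc F n (extendGL A) h)).rank)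
    simp only [not_le, Finset.card_univ, Fintype.card_fun, Fintype.card_fin] at hsplit
    rw [Fintype.card_subtype, le_div_iff₀ hG, sub_mul, one_mul, sub_le_iff_le_add, inv_pow]
    have hbad' := (le_div_iff₀ (by positivity)).2 (by exact_mod_cast hbad :
      ((Finset.univ.filter fun A : Fin (h + 1) → Matrix.GeneralLinearGroup (Fin n) F =>
        2 * (firstCols (Acirc F n (extendGL A) h)).rank < h).card : ℝ) *
          (Fintype.card F : ℝ) ^ (h / 2) ≤ (G : ℝ) ^ (h + 1))
    rw [inv_mul_eq_div]
    refine le_trans (le_of_eq ?_) (add_le_add_right hbad' _)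
    exact_mod_cast hsplit.symm
  · rw [div_le_one hG]
    have := Fintype.card_subtype_le fun A : Fin (h + 1) → Matrix.GeneralLinearGroup (Fin n) F =>
      h ≤ 2 * (firstCols (Acirc F n (extendGL A) h)).rank
    rw [Fintype.card_fun, Fintype.card_fin] at this
    exact_mod_cast this
end
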